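/- Let σ_min ≤ σ ≤ σ_max with 0 < σ_min, let κ = σ_max/σ_min, let σ_0,…,σ_{N_σ} be the Chebyshev–Lobatto nodes on [σ_min, σ_max], and let P_k be the corresponding Lagrange interpolating polynomials. Then for all x ∈ ℝ, |exp(-x²/(2σ²)) - Σ_{k=0}^{N_σ} P_k(σ) exp(-x²/(2σ_k²))| ≤ 2(κ-1)((κ-1)/(κ+1))^{N_σ}. -/

import Mathlib

lemma cg_hasSum_congr {ι E : Type*} [AddCommMonoid E] [TopologicalSpace E] {f g : ι → E} {a : E}
    (h : ∀ n, f n = g n) : HasSum f a ↔ HasSum g a := by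
  rw [funext h]

lemma cg_interp (N : ℕ) (hN : 0 < N) (a b θ σ : ℝ) (hab : a < b)
    (hσ : σ = ((Real.cos θ + 1) / 2) * (b - a) + a) (n : ℤ) (hn : n.natAbs ≤ N) :
    ∑ k : Fin (N + 1), (Lagrange.basis Finset.univ
              (fun k : Fin (N + 1) =>
                ((Real.cos (Real.pi * (k : ℕ) / (N : ℝ)) + 1) / 2) * (b - a) + a)
              k).eval σ * Real.cos (n * (Real.pi * (k : ℕ) / (N : ℝ))) = Real.cos (n * θ) := by
  have hN' : (0 : ℝ) < N := by exact_mod_cast hN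
  have hba : b - a ≠ 0 := by linarith
  set v : Fin (N + 1) → ℝ := (fun k : Fin (N + 1) =>
                ((Real.cos (Real.pi * (k : ℕ) / (N : ℝ)) + 1) / 2) * (b - a) + a) with hv
  have hinj : Set.InjOn v (Finset.univ : Finset (Fin (N + 1))) := by
    intro i _ j _ hij
    simp only [hv] at hij
    have h1 : Real.cos (Real.pi * (i : ℕ) / (N : ℝ)) = Real.cos (Real.pi * (j : ℕ) / (N : ℝ)) := by
      have := mul_right_cancel₀ hba (add_right_cancel hij)
      linarith
    have hmem : ∀ k : Fin (N + 1), Real.pi * (k : ℕ) / (N : ℝ) ∈ Set.Icc 0 Real.pi := by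
      intro k
      have hk : ((k : ℕ) : ℝ) ≤ N := by exact_mod_cast Nat.lt_succ_iff.mp k.2
      refine ⟨by positivity, ?_⟩
      rw [div_le_iff₀ hN']
      exact mul_le_mul_of_nonneg_left hk Real.pi_pos.le
    have h2 := Real.injOn_cos (hmem i) (hmem j) h1
    have h3 : ((i : ℕ) : ℝ) = (j : ℕ) := by
      have := Real.pi_pos
      field_simp at h2
      exact h2
    exact Fin.ext (by exact_mod_cast h3)
  set p : Polynomial ℝ := (Polynomial.Chebyshev.T ℝ n).comp
    (Polynomial.C (2 / (b - a)) * Polynomial.X + Polynomial.C (-2 * a / (b - a) - 1)) with hp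
  have heval : ∀ t : ℝ, p.eval (((Real.cos t + 1) / 2) * (b - a) + a) = Real.cos (n * t) := by
    intro t
    rw [hp, Polynomial.eval_comp, ← Polynomial.Chebyshev.T_real_cos]
    congr 1
    simp
    field_simp
    ring
  have hdeg : p.degree < (Finset.univ : Finset (Fin (N + 1))).card := by
    refine lt_of_le_of_lt Polynomial.degree_le_natDegree ?_
    rw [Finset.card_univ, Fintype.card_fin]
    norm_cast
    rw [hp, Polynomial.natDegree_comp, Polynomial.Chebyshev.natDegree_T]
    have : (Polynomial.C (2 / (b - a)) * Polynomial.X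
      + Polynomial.C (-2 * a / (b - a) - 1)).natDegree ≤ 1 := Polynomial.natDegree_linear_le
    nlinarith
  have h := Lagrange.eq_interpolate hinj hdeg
  have h2 := congrArg (Polynomial.eval σ) h
  rw [hσ, heval, ← hσ, Lagrange.interpolate_apply, Polynomial.eval_finsetSum] at h2
  rw [h2]
  refine Finset.sum_congr rfl fun k _ => ?_
  rw [Polynomial.eval_mul, Polynomial.eval_C, mul_comm]
  congr 1
  exact (heval _).symm

lemma cg_alias (N : ℕ) (hN : 0 < N) (n : ℤ) : ∃ m : ℤ, m.natAbs ≤ N ∧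
    ∀ k : ℕ, Real.cos (n * (Real.pi * k / (N : ℝ))) = Real.cos (m * (Real.pi * k / (N : ℝ))) := by
  have hN' : (N : ℝ) ≠ 0 := by exact_mod_cast hN.ne'
  have key : ∀ q j : ℤ, n = 2 * N * q + j → ∀ k : ℕ,
      Real.cos (n * (Real.pi * k / (N : ℝ))) = Real.cos (j * (Real.pi * k / (N : ℝ))) := by
    intro q j h k
    have : (n : ℝ) * (Real.pi * k / (N : ℝ)) = j * (Real.pi * k / (N : ℝ))
        + ((q * k : ℤ) : ℝ) * (2 * Real.pi) := by
      rw [h]; push_cast; field_simp; ring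
    rw [this, Real.cos_add_int_mul_two_pi]
  have h1 := Int.emod_add_mul_ediv n (2 * N)
  have h2 := Int.emod_nonneg n (b := 2 * N) (by omega)
  have h3 := Int.emod_lt_of_pos n (b := 2 * N) (by omega)
  by_cases h : n % (2 * N) ≤ N
  · exact ⟨n % (2 * N), by omega, key (n / (2 * N)) _ (by linarith)⟩
  · exact ⟨n % (2 * N) - 2 * N, by omega, key (n / (2 * N) + 1) _ (by linarith)⟩

lemma cg_fourier (g : ℂ → ℂ) (ρ : ℝ) (hρ : 1 < ρ)
    (hd : ∀ z : ℂ, ρ⁻¹ ≤ ‖z‖ → ‖z‖ ≤ ρ → DifferentiableAt ℂ g z)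
    (hb : ∀ z : ℂ, ρ⁻¹ ≤ ‖z‖ → ‖z‖ ≤ ρ → ‖g z‖ ≤ 1) :
    ∃ c : ℤ → ℂ, (∀ n, ‖c n‖ ≤ ρ⁻¹ ^ n.natAbs) ∧
      ∀ θ : ℝ, HasSum (fun n : ℤ => c n * Complex.exp (n * θ * Complex.I))
        (g (Complex.exp (θ * Complex.I))) := by
  have hρ0 : 0 < ρ := by linarith
  have hρi : ρ⁻¹ < 1 := inv_lt_one_of_one_lt₀ hρ
  have hρi0 : 0 < ρ⁻¹ := by positivity
  have : Fact (0 < 2 * Real.pi) := ⟨Real.two_pi_pos⟩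
  let f : C(AddCircle (2 * Real.pi), ℂ) := ⟨fun t => g (AddCircle.toCircle t), by
    rw [continuous_iff_continuousAt]
    intro t
    have h1 : ContinuousAt g (AddCircle.toCircle t : ℂ) :=
      (hd _ (by rw [Circle.norm_coe]; exact hρi.le) (by rw [Circle.norm_coe]; exact hρ.le)).continuousAt
    have h2 : Continuous fun t : AddCircle (2 * Real.pi) => (AddCircle.toCircle t : ℂ) :=
      continuous_subtype_val.comp AddCircle.continuous_toCircle
    exact ContinuousAt.comp (f := fun t : AddCircle (2 * Real.pi) => (AddCircle.toCircle t : ℂ))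
      h1 h2.continuousAt⟩
  have hfx : ∀ θ : ℝ, f (θ : AddCircle (2 * Real.pi)) = g (Complex.exp (θ * Complex.I)) := by
    intro θ
    change g (AddCircle.toCircle (θ : AddCircle (2 * Real.pi))) = _
    rw [AddCircle.toCircle_apply_mk, Circle.coe_exp]
    congr 3
    have := Real.pi_pos.ne'
    norm_cast
    field_simp
  have hfou : ∀ (n : ℤ) (θ : ℝ), fourier n (θ : AddCircle (2 * Real.pi))
      = Complex.exp (n * θ * Complex.I) := by
    intro n θ
    rw [fourier_coe_apply]
    congr 1
    have : (Real.pi : ℂ) ≠ 0 := by exact_mod_cast Real.pi_pos.ne'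
    push_cast
    field_simp
  have hcoef : ∀ n : ℤ, fourierCoeff f n = (1 / (2 * Real.pi) : ℝ) • (Complex.I⁻¹ *
      ∮ z in C(0, 1), (z - 0)⁻¹ • (z ^ (-n) * g z)) := by
    intro n
    rw [fourierCoeff_eq_intervalIntegral _ _ 0]
    congr 1
    rw [circleIntegral, ← intervalIntegral.integral_const_mul, zero_add]
    congr 1
    ext θ
    rw [hfx, hfou, deriv_circleMap]
    simp only [circleMap, zero_add, sub_zero, Complex.ofReal_one, one_mul, smul_eq_mul]
    have he : Complex.exp (θ * Complex.I) ≠ 0 := Complex.exp_ne_zero _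
    rw [← Complex.exp_int_mul]
    have hI := Complex.I_ne_zero
    field_simp
  have hdiff : ∀ (n : ℤ) (z : ℂ), ρ⁻¹ ≤ ‖z‖ → ‖z‖ ≤ ρ →
      DifferentiableAt ℂ (fun z => z ^ (-n) * g z) z := by
    intro n z h1 h2
    have hz : z ≠ 0 := by
      rintro rfl
      simp at h1
      linarith
    exact (differentiableAt_zpow.mpr (Or.inl hz)).mul (hd z h1 h2)
  have hann : ∀ (n : ℤ) (r R : ℝ), ρ⁻¹ ≤ r → r ≤ R → R ≤ ρ →
      (∮ z in C(0, R), (z - 0)⁻¹ • (z ^ (-n) * g z))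
        = ∮ z in C(0, r), (z - 0)⁻¹ • (z ^ (-n) * g z) := by
    intro n r R h1 h2 h3
    refine Complex.circleIntegral_sub_center_inv_smul_eq_of_differentiable_on_annulus_off_countable
      (by linarith) h2 Set.countable_empty ?_ ?_
    · intro z hz
      simp at hz
      exact (hdiff n z (by linarith) (by linarith)).continuousAt.continuousWithinAt
    · intro z hz
      simp at hz
      exact hdiff n z (by linarith) (by linarith)
  have hR : ∀ (n : ℤ) (R : ℝ), ρ⁻¹ ≤ R → R ≤ ρ →
      ‖∮ z in C(0, R), (z - 0)⁻¹ • (z ^ (-n) * g z)‖ ≤ 2 * Real.pi * R ^ (-n) := by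
    intro n R h1 h2
    have hR0 : 0 < R := by linarith
    have := circleIntegral.norm_integral_le_of_norm_le_const (c := 0) (C := R⁻¹ * R ^ (-n))
      (f := fun z => (z - 0)⁻¹ • (z ^ (-n) * g z)) hR0.le (by
        intro z hz
        have hz' : ‖z‖ = R := by simpa using hz
        have := hb z (by linarith) (by linarith)
        rw [norm_smul, norm_mul, norm_inv, norm_zpow, sub_zero, hz']
        have h3 : 0 < R ^ (-n) := by positivity
        have h4 : 0 < R⁻¹ := by positivity
        gcongr
        nlinarith)
    refine this.trans (le_of_eq ?_)
    field_simp
  have hbound : ∀ n : ℤ, ‖fourierCoeff f n‖ ≤ ρ⁻¹ ^ n.natAbs := by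
    intro n
    have h : ‖∮ z in C(0, 1), (z - 0)⁻¹ • (z ^ (-n) * g z)‖
        ≤ 2 * Real.pi * ρ⁻¹ ^ n.natAbs := by
      rcases le_total 0 n with hn | hn
      · rw [← hann n 1 ρ hρi.le hρ.le le_rfl]
        refine (hR n ρ (by linarith) le_rfl).trans (le_of_eq ?_)
        lift n to ℕ using hn
        simp
      · rw [hann n ρ⁻¹ 1 le_rfl hρi.le hρ.le]
        refine (hR n ρ⁻¹ le_rfl (by linarith)).trans (le_of_eq ?_)
        obtain ⟨m, rfl⟩ : ∃ m : ℕ, n = -m := ⟨n.natAbs, by omega⟩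
        simp
    rw [hcoef, norm_smul, norm_mul, norm_inv, Complex.norm_I, inv_one, one_mul, Real.norm_eq_abs,
      abs_of_pos (by positivity)]
    rw [div_mul_eq_mul_div, div_le_iff₀ Real.two_pi_pos]
    linarith
  have hsumm : Summable (fourierCoeff f) := by
    refine Summable.of_norm_bounded (g := fun n : ℤ => ρ⁻¹ ^ n.natAbs) ?_ hbound
    have hg := summable_geometric_of_lt_one hρi0.le hρi
    refine Summable.of_nat_of_neg (by simpa using hg) (by simpa using hg)
  refine ⟨fourierCoeff f, hbound, fun θ => ?_⟩
  have := has_pointwise_sum_fourier_series_of_summable hsumm (θ : AddCircle (2 * Real.pi))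
  simpa only [hfx, hfou, smul_eq_mul] using this

lemma cg_tail (q : ℝ) (hq : 0 < q) (hq1 : q < 1) (N : ℕ) :
    HasSum (fun n : ℤ => if n.natAbs ≤ N then 0 else 2 * q ^ n.natAbs)
      (4 * (q ^ (N + 1) / (1 - q))) := by
  have h0 : HasSum (fun n : ℕ => 2 * q ^ (N + 1 + n)) (2 * (q ^ (N + 1) / (1 - q))) := by
    have := (hasSum_geometric_of_lt_one hq.le hq1).mul_left (2 * q ^ (N + 1))
    have e1 : (fun n : ℕ => 2 * q ^ (N + 1 + n)) = fun i : ℕ => 2 * q ^ (N + 1) * q ^ i := by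
      funext n; ring
    have e2 : 2 * (q ^ (N + 1) / (1 - q)) = 2 * q ^ (N + 1) * (1 - q)⁻¹ := by
      rw [div_eq_mul_inv, mul_assoc]
    rw [e1, e2]
    exact this
  have h1 : HasSum (fun n : ℕ => if n ≤ N then (0 : ℝ) else 2 * q ^ n)
      (2 * (q ^ (N + 1) / (1 - q))) := by
    rw [← hasSum_nat_add_iff' (N + 1), Finset.sum_eq_zero, sub_zero]
    · refine (cg_hasSum_congr ?_).mpr h0
      intro n
      rw [if_neg (by omega), add_comm n]
    · intro i hi
      rw [if_pos (by simp at hi; omega)]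
  have h2 : HasSum (fun n : ℕ => if n + 1 ≤ N then (0 : ℝ) else 2 * q ^ (n + 1))
      (2 * (q ^ (N + 1) / (1 - q))) := by
    have := (hasSum_nat_add_iff' 1).mpr h1
    simpa using this
  have h3 := HasSum.of_nat_of_neg_add_one (f := fun n : ℤ => if n.natAbs ≤ N then (0 : ℝ) else 2 * q ^ n.natAbs)
    (by simpa using h1) (m' := 2 * (q ^ (N + 1) / (1 - q))) (by
      have e : (fun n : ℕ => if (-((n : ℤ) + 1)).natAbs ≤ N then (0 : ℝ)
          else 2 * q ^ (-((n : ℤ) + 1)).natAbs)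
          = fun n : ℕ => if n + 1 ≤ N then (0 : ℝ) else 2 * q ^ (n + 1) := by
        funext n
        have : (-((n : ℤ) + 1)).natAbs = n + 1 := by omega
        rw [this]
      rw [e]
      exact h2)
  have e : 4 * (q ^ (N + 1) / (1 - q))
      = 2 * (q ^ (N + 1) / (1 - q)) + 2 * (q ^ (N + 1) / (1 - q)) := by ring
  rw [e]
  exact h3

lemma cg_sector (ρ h : ℝ) (hρ : 1 < ρ) (hh : 0 < h) (z : ℂ) (h1 : ρ⁻¹ ≤ ‖z‖) (h2 : ‖z‖ ≤ ρ) :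
    |(h * (ρ + (z + z⁻¹) / 2) : ℂ).im| < (h * (ρ + (z + z⁻¹) / 2) : ℂ).re := by
  have hρ0 : 0 < ρ := by linarith
  have hz0 : 0 < ‖z‖ := lt_of_lt_of_le (by positivity) h1
  set s := Complex.normSq z with hs
  have hsn : s = ‖z‖ ^ 2 := Complex.normSq_eq_norm_sq z
  have hs0 : 0 < s := by rw [hsn]; positivity
  have hsu : s ≤ ρ ^ 2 := by rw [hsn]; gcongr
  have hsl : (ρ ^ 2)⁻¹ ≤ s := by rw [hsn, ← inv_pow]; gcongr
  have hsl' : 1 ≤ s * ρ ^ 2 := by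
    rwa [inv_le_iff_one_le_mul₀ (by positivity)] at hsl
  have hss : z.re * z.re + z.im * z.im = s := by rw [hs, Complex.normSq_apply]
  have hρ2 : 1 < ρ ^ 2 := by nlinarith
  have hkey : s + s⁻¹ < 2 * ρ ^ 2 := by
    have : s⁻¹ ≤ ρ ^ 2 := by
      rw [inv_le_iff_one_le_mul₀ hs0]; linarith
    rcases lt_or_eq_of_le hsu with h | h
    · linarith
    · have : s⁻¹ < 1 := inv_lt_one_of_one_lt₀ (by linarith)
      linarith
  have hre : (h * (ρ + (z + z⁻¹) / 2) : ℂ).re = h * (ρ + z.re * (1 + s⁻¹) / 2) := by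
    have : (h * (ρ + (z + z⁻¹) / 2) : ℂ) = ((h : ℝ) : ℂ) * (ρ + ((1 / 2 : ℝ) : ℂ) * (z + z⁻¹)) := by
      push_cast; ring
    rw [this, Complex.re_ofReal_mul, Complex.add_re, Complex.re_ofReal_mul, Complex.add_re,
      Complex.inv_re, Complex.ofReal_re, ← hs]
    ring
  have him : (h * (ρ + (z + z⁻¹) / 2) : ℂ).im = h * (z.im * (1 - s⁻¹) / 2) := by
    have : (h * (ρ + (z + z⁻¹) / 2) : ℂ) = ((h : ℝ) : ℂ) * (ρ + ((1 / 2 : ℝ) : ℂ) * (z + z⁻¹)) := by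
      push_cast; ring
    rw [this, Complex.im_ofReal_mul, Complex.add_im, Complex.im_ofReal_mul, Complex.add_im,
      Complex.inv_im, Complex.ofReal_im, ← hs]
    ring
  rw [hre, him]
  set A := z.re * (1 + s⁻¹) / 2
  set B := z.im * (1 - s⁻¹) / 2
  have hAB : ∀ e : ℝ, e ^ 2 = 1 → (A + e * B) ^ 2 < ρ ^ 2 := by
    intro e he
    have hi : s * s⁻¹ = 1 := mul_inv_cancel₀ hs0.ne'
    have hcs : (A + e * B) ^ 2 ≤ (z.re * z.re + z.im * z.im)
        * (((1 + s⁻¹) / 2) ^ 2 + ((1 - s⁻¹) / 2) ^ 2) := by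
      have h5 : (A + e * B) ^ 2 = (z.re * ((1 + s⁻¹) / 2) + z.im * (e * ((1 - s⁻¹) / 2))) ^ 2 := by
        simp only [A, B]; ring
      have h6 : ((1 - s⁻¹) / 2) ^ 2 = (e * ((1 - s⁻¹) / 2)) ^ 2 := by rw [mul_pow, he, one_mul]
      rw [h5, h6]
      nlinarith [sq_nonneg (z.re * (e * ((1 - s⁻¹) / 2)) - z.im * ((1 + s⁻¹) / 2))]
    rw [hss] at hcs
    have : s * (((1 + s⁻¹) / 2) ^ 2 + ((1 - s⁻¹) / 2) ^ 2) = (s + s⁻¹) / 2 := by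
      field_simp
      ring
    linarith
  have hA1 := abs_lt_of_sq_lt_sq (hAB 1 (by norm_num)) hρ0.le
  have hA2 := abs_lt_of_sq_lt_sq (hAB (-1) (by norm_num)) hρ0.le
  rw [abs_lt] at hA1 hA2
  rw [abs_lt]
  constructor <;> nlinarith [hA1.1, hA2.1]

lemma cg_exp_bound (x : ℝ) (w : ℂ) (hw : |w.im| < w.re) :
    w ≠ 0 ∧ ‖Complex.exp (-x ^ 2 / (2 * w ^ 2))‖ ≤ 1 := by
  have hre : 0 < w.re := lt_of_le_of_lt (abs_nonneg _) hw
  refine ⟨by rintro rfl; simp at hre, ?_⟩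
  rw [Complex.norm_exp, Real.exp_le_one_iff]
  have : (-x ^ 2 / (2 * w ^ 2) : ℂ) = (((-x ^ 2 / 2 : ℝ)) : ℂ) * (w ^ 2)⁻¹ := by
    push_cast; field_simp
  rw [this, Complex.re_ofReal_mul, Complex.inv_re]
  have h2 : 0 ≤ (w ^ 2).re := by
    have := sq_lt_sq' (abs_lt.mp hw).1 (abs_lt.mp hw).2
    rw [pow_two, Complex.mul_re]; nlinarith
  have h3 : 0 ≤ (w ^ 2).re / Complex.normSq (w ^ 2) := div_nonneg h2 (Complex.normSq_nonneg _)
  nlinarith [mul_nonneg (sq_nonneg x) h3]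

/-- Chebyshev interpolation of the Gaussian in the width parameter: uniform error bound
`2(κ-1)((κ-1)/(κ+1))^{N_σ}` with `κ = σ_max/σ_min`, for interpolation on the
Chebyshev–Lobatto nodes of `[σ_min, σ_max]`. -/
theorem stmt5 (σmin σmax : ℝ) (h0 : 0 < σmin) (hlt : σmin < σmax)
    (Nσ : ℕ) (hN : 0 < Nσ) (σ : ℝ) (hσ : σ ∈ Set.Icc σmin σmax) (x : ℝ) :
    |Real.exp (-x^2 / (2*σ^2)) -
        ∑ k : Fin (Nσ + 1),
          (Lagrange.basis Finset.univ
              (fun k : Fin (Nσ + 1) =>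
                ((Real.cos (Real.pi * (k : ℕ) / (Nσ : ℝ)) + 1) / 2) * (σmax - σmin) + σmin)
              k).eval σ
            * Real.exp (-x^2 /
                (2 * (((Real.cos (Real.pi * (k : ℕ) / (Nσ : ℝ)) + 1) / 2) * (σmax - σmin) + σmin)^2))|
      ≤ 2 * (σmax/σmin - 1) * ((σmax/σmin - 1) / (σmax/σmin + 1)) ^ Nσ := by
  have hba : 0 < σmax - σmin := by linarith
  set h : ℝ := (σmax - σmin) / 2 with hh
  set ρ : ℝ := (σmax + σmin) / (σmax - σmin) with hρdef
  have hh0 : 0 < h := by positivity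
  have hρ : 1 < ρ := by rw [hρdef, lt_div_iff₀ hba]; linarith
  set g : ℂ → ℂ := fun z => Complex.exp (-x ^ 2 / (2 * (h * (ρ + (z + z⁻¹) / 2)) ^ 2)) with hg
  obtain ⟨c, hc, hsum⟩ := cg_fourier g ρ hρ (by
      intro z h1 h2
      have hw := (cg_exp_bound x _ (cg_sector ρ h hρ hh0 z h1 h2)).1
      have hz : z ≠ 0 := by
        rintro rfl
        rw [norm_zero] at h1
        have : 0 < ρ⁻¹ := by positivity
        linarith
      have hw2 : (2 * (h * (ρ + (z + z⁻¹) / 2)) ^ 2 : ℂ) ≠ 0 :=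
        mul_ne_zero two_ne_zero (pow_ne_zero 2 hw)
      simp only [hg]
      fun_prop (disch := assumption))
    (fun z h1 h2 => (cg_exp_bound x _ (cg_sector ρ h hρ hh0 z h1 h2)).2)
  -- values on the unit circle
  have hval : ∀ θ : ℝ, g (Complex.exp (θ * Complex.I)) =
      ((Real.exp (-x ^ 2 / (2 * (((Real.cos θ + 1) / 2) * (σmax - σmin) + σmin) ^ 2)) : ℝ) : ℂ) := by
    intro θ
    have h1 : (Complex.exp (θ * Complex.I) + (Complex.exp (θ * Complex.I))⁻¹) / 2
        = Complex.cos θ := by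
      rw [← Complex.exp_neg, Complex.cos, neg_mul]
    have h2 : (h * (ρ + Complex.cos θ) : ℂ)
        = ((((Real.cos θ + 1) / 2) * (σmax - σmin) + σmin : ℝ) : ℂ) := by
      rw [← Complex.ofReal_cos, ← Complex.ofReal_add, ← Complex.ofReal_mul]
      congr 1
      rw [hh, hρdef]
      field_simp
      ring
    simp only [hg]
    rw [h1, h2]
    push_cast
    rfl
  have hcos : ∀ θ : ℝ, HasSum (fun n : ℤ => c n * (Real.cos (n * θ) : ℂ))
      ((Real.exp (-x ^ 2 / (2 * (((Real.cos θ + 1) / 2) * (σmax - σmin) + σmin) ^ 2)) : ℝ) : ℂ) := by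
    intro θ
    have h1 := hsum θ
    have h2 := hsum (-θ)
    rw [hval] at h1 h2
    rw [Real.cos_neg] at h2
    have h3 := (h1.add h2).mul_left (1 / 2 : ℂ)
    have e : ∀ v : ℂ, 1 / 2 * (v + v) = v := by intro v; ring
    rw [e] at h3
    refine (cg_hasSum_congr ?_).mp h3
    intro n
    push_cast
    rw [Complex.cos]
    have e2 : (n * -θ * Complex.I : ℂ) = -(n * θ) * Complex.I := by ring
    rw [e2]
    ring
  -- the angle of `σ`
  obtain ⟨θ, hθ⟩ : ∃ θ : ℝ, σ = ((Real.cos θ + 1) / 2) * (σmax - σmin) + σmin := by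
    refine ⟨Real.arccos (2 * (σ - σmin) / (σmax - σmin) - 1), ?_⟩
    rw [Real.cos_arccos]
    · field_simp
      ring
    · have : 0 ≤ 2 * (σ - σmin) / (σmax - σmin) :=
        div_nonneg (by linarith [hσ.1]) hba.le
      linarith
    · have : 2 * (σ - σmin) / (σmax - σmin) ≤ 2 := by
        rw [div_le_iff₀ hba]; linarith [hσ.2]
      linarith
  set P : Fin (Nσ + 1) → ℝ := fun k => (Lagrange.basis Finset.univ
              (fun k : Fin (Nσ + 1) =>
                ((Real.cos (Real.pi * (k : ℕ) / (Nσ : ℝ)) + 1) / 2) * (σmax - σmin) + σmin)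
              k).eval σ with hP
  set E : ℤ → ℝ := fun n => Real.cos (n * θ) -
    ∑ k : Fin (Nσ + 1), P k * Real.cos (n * (Real.pi * (k : ℕ) / (Nσ : ℝ))) with hE
  have hE0 : ∀ n : ℤ, n.natAbs ≤ Nσ → E n = 0 := by
    intro n hn
    simp only [hE, hP]
    rw [cg_interp Nσ hN σmin σmax θ σ hlt hθ n hn, sub_self]
  have hE2 : ∀ n : ℤ, |E n| ≤ 2 := by
    intro n
    obtain ⟨m, hm, hmk⟩ := cg_alias Nσ hN n
    have : E n = Real.cos (n * θ) - Real.cos (m * θ) := by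
      simp only [hE, hP]
      rw [← cg_interp Nσ hN σmin σmax θ σ hlt hθ m hm]
      simp only [hmk]
    rw [this]
    calc _ ≤ |Real.cos (n * θ)| + |Real.cos (m * θ)| := abs_sub _ _
      _ ≤ 2 := by linarith [Real.abs_cos_le_one (n * θ), Real.abs_cos_le_one (m * θ)]
  have hfin := (hcos θ).sub (hasSum_sum (s := Finset.univ) fun (k : Fin (Nσ + 1)) _ =>
    (hcos (Real.pi * (k : ℕ) / (Nσ : ℝ))).mul_left (P k : ℂ))
  have hfin2 : HasSum (fun n : ℤ => c n * (E n : ℂ))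
      ((Real.exp (-x^2 / (2*σ^2)) - ∑ k : Fin (Nσ + 1), P k * Real.exp (-x^2 /
                (2 * (((Real.cos (Real.pi * (k : ℕ) / (Nσ : ℝ)) + 1) / 2) * (σmax - σmin) + σmin)^2))
                  : ℝ) : ℂ) := by
    rw [← hθ] at hfin
    rw [Complex.ofReal_sub, Complex.ofReal_sum]
    simp only [Complex.ofReal_mul (P _)]
    refine (cg_hasSum_congr ?_).mp hfin
    intro n
    simp only [hE]
    rw [Complex.ofReal_sub, Complex.ofReal_sum, mul_sub, Finset.mul_sum]
    congr 1
    refine Finset.sum_congr rfl fun k _ => ?_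
    rw [Complex.ofReal_mul]
    ring
  have hq0 : 0 < ρ⁻¹ := by positivity
  have htail := cg_tail ρ⁻¹ hq0 (inv_lt_one_of_one_lt₀ hρ) Nσ
  have hle := tsum_of_norm_bounded htail (f := fun n : ℤ => c n * (E n : ℂ)) (by
    intro n
    rw [norm_mul, Complex.norm_real, Real.norm_eq_abs]
    split_ifs with hn
    · rw [hE0 n hn]; simp
    · have := mul_le_mul (hc n) (hE2 n) (abs_nonneg _) (by positivity)
      linarith)
  rw [hfin2.tsum_eq, Complex.norm_real, Real.norm_eq_abs] at hle
  refine hle.trans (le_of_eq ?_)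
  have hr : ρ⁻¹ = (σmax / σmin - 1) / (σmax / σmin + 1) := by
    rw [hρdef]
    have : 0 < σmax := by linarith
    field_simp
  have h1r : ρ⁻¹ / (1 - ρ⁻¹) = (σmax / σmin - 1) / 2 := by
    have e1 : ρ⁻¹ / (1 - ρ⁻¹) = 1 / (ρ - 1) := by
      have : ρ - 1 ≠ 0 := by linarith
      have : ρ ≠ 0 := by positivity
      field_simp
    have e2 : ρ - 1 = 2 * σmin / (σmax - σmin) := by
      rw [hρdef]; field_simp; ring
    rw [e1, e2]
    field_simp
  rw [← hr, pow_succ, mul_div_assoc, h1r]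
  ring
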